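/- Any two-color Babylon position consisting of 2 red singleton stacks, k blue singleton stacks with k ≥ 4 even (so the total number of stacks, k+5, is odd), exactly two red stacks of heights 2u and 2 with u ≥ 1, and exactly one blue stack of height 2v with v ≥ 1, is a first-player win; that is, the player to move wins with best play. -/

import Mathlib

/-- A chip color: `true` = red, `false` = blue.  A stack is a nonempty list of
chips, the head of the list being the top chip; the color of a stack is the
color of its top chip.  A position is a finite multiset of stacks. -/
abbrev Stack := List Bool

abbrev Position := Multiset Stack

/-- A legal move replaces two stacks `s` and `t` that have equal length or
equal top color by the single concatenated stack `s ++ t`. -/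
def Move (P Q : Position) : Prop :=
  ∃ s t : Stack, s ≠ [] ∧ t ≠ [] ∧ s ∈ P ∧ t ∈ P.erase s ∧
    (s.length = t.length ∨ s.head? = t.head?) ∧
    Q = (s ++ t) ::ₘ (P.erase s).erase t

/-- Auxiliary predicate, with the number of stacks as fuel: the player to move
wins iff there is a legal move to a position that is not a first-player win. -/
def FirstWinAux : ℕ → Position → Prop
  | 0, _ => False
  | n + 1, P => ∃ Q, Move P Q ∧ ¬ FirstWinAux n Q

/-- The position is a first-player win: the player to move has a winning
strategy.  Since each move decreases the number of stacks by exactly one,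
`Multiset.card P` is enough fuel. -/
def FirstWin (P : Position) : Prop := FirstWinAux (Multiset.card P) P

/-- The initial position with `p` red singleton stacks and `q` blue
singleton stacks. -/
def initPos (p q : ℕ) : Position :=
  Multiset.replicate p [true] + Multiset.replicate q [false]

set_option linter.unusedSimpArgs false

/-- `Pick M x N`: removing one entry `x` from `M` leaves `N`. -/
def Pick (M : Multiset ℕ) (x : ℕ) (N : Multiset ℕ) : Prop := M = x ::ₘ N

/-- `Merge M N`: `N` arises from `M` by adding up two of its entries. -/
def Merge (M N : Multiset ℕ) : Prop := ∃ x y K, M = x ::ₘ y ::ₘ K ∧ N = (x + y) ::ₘ K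

/-- A move on the multisets of heights of the red and of the blue stacks. -/
inductive HeightMove : Multiset ℕ → Multiset ℕ → Multiset ℕ → Multiset ℕ → Prop
  | red {R R' B} : Merge R R' → HeightMove R B R' B
  | blue {R B B'} : Merge B B' → HeightMove R B R B'
  | captureByRed {R B x R' B'} : Pick R x R' → Pick B x B' → HeightMove R B (2 * x ::ₘ R') B'
  | captureByBlue {R B x R' B'} : Pick R x R' → Pick B x B' → HeightMove R B R' (2 * x ::ₘ B')

/-- The player to move wins the game with red heights `R` and blue heights `B`. -/
inductive Wins : Multiset ℕ → Multiset ℕ → Prop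
  | intro {R B R' B'} : HeightMove R B R' B' →
      (∀ R'' B'', HeightMove R' B' R'' B'' → Wins R'' B'') → Wins R B

/-- The player to move loses the game with red heights `R` and blue heights `B`. -/
def Loses (R B : Multiset ℕ) : Prop := ∀ R' B', HeightMove R B R' B' → Wins R' B'

theorem loses_iff {R B : Multiset ℕ} : Loses R B ↔
    (∀ R', Merge R R' → Wins R' B) ∧ (∀ B', Merge B B' → Wins R B') ∧
    (∀ x R', Pick R x R' → ∀ y B', Pick B y B' →
      x = y → Wins (2 * x ::ₘ R') B' ∧ Wins R' (2 * x ::ₘ B')) := by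
  constructor
  · intro h
    refine ⟨fun R' hR => h _ _ (.red hR), fun B' hB => h _ _ (.blue hB), ?_⟩
    rintro x R' hR _ B' hB rfl
    exact ⟨h _ _ (.captureByRed hR hB), h _ _ (.captureByBlue hR hB)⟩
  · rintro ⟨h₁, h₂, h₃⟩ R' B' h
    cases h with
    | red h => exact h₁ _ h
    | blue h => exact h₂ _ h
    | captureByRed h h' => exact (h₃ _ _ h _ _ h' rfl).1
    | captureByBlue h h' => exact (h₃ _ _ h _ _ h' rfl).2

theorem Wins.red {R R' B : Multiset ℕ} (x y : ℕ) (N : Multiset ℕ) (h : Loses R' B)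
    (hR : R = x ::ₘ y ::ₘ N) (hR' : R' = (x + y) ::ₘ N) : Wins R B :=
  .intro (.red ⟨x, y, N, hR, hR'⟩) h

theorem Wins.blue {R B B' : Multiset ℕ} (x y : ℕ) (N : Multiset ℕ) (h : Loses R B')
    (hB : B = x ::ₘ y ::ₘ N) (hB' : B' = (x + y) ::ₘ N) : Wins R B :=
  .intro (.blue ⟨x, y, N, hB, hB'⟩) h

theorem Wins.captureByRed {R B R' B' : Multiset ℕ} (x : ℕ) (N : Multiset ℕ) (h : Loses R' B')
    (hR : R = x ::ₘ N) (hB : B = x ::ₘ B') (hR' : R' = 2 * x ::ₘ N) : Wins R B := by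
  subst hR'
  exact .intro (.captureByRed hR hB) h

theorem Wins.captureByBlue {R B R' B' : Multiset ℕ} (x : ℕ) (N : Multiset ℕ) (h : Loses R' B')
    (hR : R = x ::ₘ R') (hB : B = x ::ₘ N) (hB' : B' = 2 * x ::ₘ N) : Wins R B := by
  subst hB'
  exact .intro (.captureByBlue hR hB) h

/-- `m` stacks of height one. -/
def ones (m : ℕ) : Multiset ℕ := Multiset.replicate m 1

theorem ones_succ (m : ℕ) : ones (m + 1) = 1 ::ₘ ones m := Multiset.replicate_succ 1 m

@[simp] theorem card_ones (m : ℕ) : (ones m).card = m := by simp [ones]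
@[simp] theorem sum_ones (m : ℕ) : (ones m).sum = m := by simp [ones]
@[simp] theorem mem_ones {m x : ℕ} : x ∈ ones m ↔ m ≠ 0 ∧ x = 1 := by
  simp [ones, Multiset.mem_replicate]
theorem count_ones (m x : ℕ) : (ones m).count x = if x = 1 then m else 0 := by
  simp [ones, Multiset.count_replicate, eq_comm]

theorem countP_ones (m : ℕ) (p : ℕ → Prop) [DecidablePred p] :
    (ones m).countP p = if p 1 then m else 0 := by
  split_ifs with h
  · rw [Multiset.countP_eq_card.2, card_ones]
    rintro e he
    rwa [(mem_ones.1 he).2]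
  · rw [Multiset.countP_eq_zero]
    rintro e he
    rwa [(mem_ones.1 he).2]

theorem pick_cons {a x : ℕ} {S N : Multiset ℕ} :
    Pick (a ::ₘ S) x N ↔ (x = a ∧ N = S) ∨ ∃ N', Pick S x N' ∧ N = a ::ₘ N' := by
  unfold Pick
  rw [Multiset.cons_eq_cons]
  constructor
  · rintro (⟨rfl, rfl⟩ | ⟨-, K, rfl, rfl⟩)
    · exact .inl ⟨rfl, rfl⟩
    · exact .inr ⟨K, rfl, rfl⟩
  · rintro (⟨rfl, rfl⟩ | ⟨K, rfl, rfl⟩)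
    · exact .inl ⟨rfl, rfl⟩
    · by_cases h : a = x
      · exact .inl ⟨h, by rw [h]⟩
      · exact .inr ⟨h, K, rfl, rfl⟩

theorem merge_cons {a : ℕ} {S N : Multiset ℕ} : Merge (a ::ₘ S) N ↔
    (∃ y K, Pick S y K ∧ N = (a + y) ::ₘ K) ∨ ∃ N', Merge S N' ∧ N = a ::ₘ N' := by
  constructor
  · rintro ⟨x, y, K, h, rfl⟩
    rcases pick_cons.1 (show Pick (a ::ₘ S) x (y ::ₘ K) from h) with ⟨rfl, rfl⟩ | ⟨N', rfl, h'⟩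
    · exact .inl ⟨y, K, rfl, rfl⟩
    · rcases pick_cons.1 (show Pick (a ::ₘ N') y K from h'.symm) with ⟨rfl, rfl⟩ | ⟨N'', rfl, rfl⟩
      · exact .inl ⟨x, _, rfl, by rw [add_comm]⟩
      · exact .inr ⟨_, ⟨x, y, N'', rfl, rfl⟩, Multiset.cons_swap ..⟩
  · rintro (⟨y, K, rfl, rfl⟩ | ⟨_, ⟨x, y, K, rfl, rfl⟩, rfl⟩)
    · exact ⟨a, y, K, rfl, rfl⟩
    · exact ⟨x, y, a ::ₘ K, by rw [Multiset.cons_swap a, Multiset.cons_swap a],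
        Multiset.cons_swap ..⟩

theorem forall_pick_zero {p : ℕ → Multiset ℕ → Prop} : (∀ x N, Pick 0 x N → p x N) ↔ True := by
  simp [Pick]

theorem forall_pick_cons {a : ℕ} {S : Multiset ℕ} {p : ℕ → Multiset ℕ → Prop} :
    (∀ x N, Pick (a ::ₘ S) x N → p x N) ↔ p a S ∧ ∀ x N, Pick S x N → p x (a ::ₘ N) := by
  simp only [pick_cons]
  constructor
  · exact fun h => ⟨h _ _ (.inl ⟨rfl, rfl⟩), fun x N hN => h _ _ (.inr ⟨N, hN, rfl⟩)⟩
  · rintro ⟨h₁, h₂⟩ x N (⟨rfl, rfl⟩ | ⟨N, hN, rfl⟩)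
    exacts [h₁, h₂ _ _ hN]

theorem forall_pick_ones {m : ℕ} {p : ℕ → Multiset ℕ → Prop} :
    (∀ x N, Pick (ones m) x N → p x N) ↔ ∀ n, m = n + 1 → p 1 (ones n) := by
  constructor
  · rintro h n rfl
    exact h _ _ (ones_succ n)
  · rintro h x N hN
    unfold Pick at hN
    obtain ⟨hm, rfl⟩ : m ≠ 0 ∧ x = 1 := mem_ones.1 (hN ▸ Multiset.mem_cons_self x N)
    obtain ⟨n, rfl⟩ := Nat.exists_eq_succ_of_ne_zero hm
    rw [Nat.succ_eq_add_one, ones_succ, Multiset.cons_inj_right] at hN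
    exact hN ▸ h n rfl

theorem forall_merge_zero {p : Multiset ℕ → Prop} : (∀ N, Merge 0 N → p N) ↔ True := by
  simp [Merge]

theorem forall_merge_cons {a : ℕ} {S : Multiset ℕ} {p : Multiset ℕ → Prop} :
    (∀ N, Merge (a ::ₘ S) N → p N) ↔
      (∀ x N, Pick S x N → p ((a + x) ::ₘ N)) ∧ ∀ N, Merge S N → p (a ::ₘ N) := by
  simp only [merge_cons]
  constructor
  · exact fun h => ⟨fun x N hN => h _ (.inl ⟨x, N, hN, rfl⟩), fun N hN => h _ (.inr ⟨N, hN, rfl⟩)⟩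
  · rintro ⟨h₁, h₂⟩ _ (⟨x, N, hN, rfl⟩ | ⟨N, hN, rfl⟩)
    exacts [h₁ _ _ hN, h₂ _ hN]

theorem forall_merge_ones {m : ℕ} {p : Multiset ℕ → Prop} :
    (∀ N, Merge (ones m) N → p N) ↔ ∀ n, m = n + 2 → p (2 ::ₘ ones n) := by
  cases m with
  | zero => simp [Merge, ones]
  | succ m =>
    induction m generalizing p with
    | zero =>
      rw [ones_succ, forall_merge_cons, show ones 0 = 0 from rfl, forall_pick_zero,
        forall_merge_zero]
      simp
    | succ m ih =>
      rw [ones_succ, forall_merge_cons, forall_pick_ones, ih]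
      constructor
      · rintro ⟨h, -⟩ n hn
        obtain rfl : n = m := by omega
        exact h n rfl
      · intro h
        refine ⟨fun n hn => ?_, fun n hn => ?_⟩
        · obtain rfl : n = m := by omega
          exact h n rfl
        · obtain rfl : m = n + 1 := by omega
          rw [Multiset.cons_swap, ← ones_succ]
          exact h _ rfl

/-- Unless `R = {a}` is met by a blue multiset all of whose entries are `a / 2` after one
merger, one of these conditions holds. -/
def Untrapped (a : ℕ) (M : Multiset ℕ) : Prop :=
  M.card ≤ 3 ∨ M.sum < a ∨ (∃ e ∈ M, a < 2 * e) ∨ 3 ≤ M.countP (fun e => 2 * e ≠ a)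

theorem Untrapped.exists_of_merge {a : ℕ} {M N : Multiset ℕ} (h : Untrapped a M)
    (hc : M.card % 2 = 1) (hs : M.sum ≠ a) (hM : Merge M N) : ∃ e ∈ N, 2 * e ≠ a := by
  obtain ⟨x, y, K, rfl, rfl⟩ := hM
  simp only [Multiset.card_cons, Multiset.sum_cons, Untrapped] at *
  by_contra! hall
  have hxy := hall (x + y) (Multiset.mem_cons_self _ _)
  have hK : ∀ e ∈ K, 2 * e = a := fun e he => hall e (Multiset.mem_cons_of_mem he)
  rcases h with h | h | ⟨e, he, hlt⟩ | h
  · obtain ⟨z, rfl⟩ := Multiset.card_eq_one.1 (show K.card = 1 by omega)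
    have := hK z (by simp)
    simp at hs
    omega
  · obtain ⟨z, hz⟩ := Multiset.card_pos_iff_exists_mem.1 (show 0 < K.card by omega)
    obtain ⟨K', rfl⟩ := Multiset.exists_cons_of_mem hz
    have := hK z hz
    simp at h
    omega
  · simp only [Multiset.mem_cons] at he
    rcases he with rfl | rfl | he
    · omega
    · omega
    · have := hK e he
      omega
  · have h0 : K.countP (fun e => 2 * e ≠ a) = 0 := by
      rw [Multiset.countP_eq_zero]
      exact fun e he => not_not.2 (hK e he)
    rw [Multiset.countP_cons, Multiset.countP_cons, h0] at h
    split_ifs at h <;> omega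

theorem Merge.card_add_one {M N : Multiset ℕ} (h : Merge M N) : N.card + 1 = M.card := by
  obtain ⟨x, y, K, rfl, rfl⟩ := h
  simp

theorem Merge.sum_eq {M N : Multiset ℕ} (h : Merge M N) : N.sum = M.sum := by
  obtain ⟨x, y, K, rfl, rfl⟩ := h
  simp [add_assoc]

theorem Merge.pos {M N : Multiset ℕ} (h : Merge M N) (hp : ∀ e ∈ M, 0 < e) : ∀ e ∈ N, 0 < e := by
  obtain ⟨x, y, K, rfl, rfl⟩ := h
  intro e he
  rcases Multiset.mem_cons.1 he with rfl | he
  · have := hp x (by simp)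
    omega
  · exact hp e (by simp [he])

theorem Merge.count_le_one {M N : Multiset ℕ} {a : ℕ} (h : Merge M N) (ha : a ∉ M) :
    N.count a ≤ 1 := by
  obtain ⟨x, y, K, rfl, rfl⟩ := h
  have : K.count a = 0 := Multiset.count_eq_zero.2 fun h => ha (by simp [h])
  rw [Multiset.count_cons, this]
  split_ifs <;> omega

theorem exists_good_merge {a : ℕ} {M : Multiset ℕ} (hc : M.card % 2 = 0) (hc4 : 4 ≤ M.card)
    (hp : ∀ e ∈ M, 0 < e) (ha : M.count a ≤ 1) (he : ∃ e ∈ M, 2 * e ≠ a) :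
    ∃ N, Merge M N ∧ a ∉ N ∧ Untrapped a N := by
  by_cases haM : a ∈ M
  · obtain ⟨M, rfl⟩ := Multiset.exists_cons_of_mem haM
    rw [Multiset.card_cons] at hc4
    obtain ⟨p, hpM⟩ := Multiset.card_pos_iff_exists_mem.1 (show 0 < M.card by omega)
    obtain ⟨N, rfl⟩ := Multiset.exists_cons_of_mem hpM
    have hp0 := hp p (by simp)
    rw [Multiset.count_cons_self] at ha
    have hN : a ∉ p ::ₘ N := Multiset.count_eq_zero.1 (by omega)
    simp only [Multiset.mem_cons, not_or] at hN
    refine ⟨_, ⟨a, p, N, rfl, rfl⟩, ?_, .inr (.inr (.inl ⟨a + p, by simp, by omega⟩))⟩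
    simp only [Multiset.mem_cons, not_or]
    exact ⟨by omega, hN.2⟩
  by_cases hbig : ∃ g ∈ M, a < 2 * g
  · obtain ⟨g, hg, hag⟩ := hbig
    obtain ⟨M, rfl⟩ := Multiset.exists_cons_of_mem hg
    simp only [Multiset.mem_cons, not_or] at haM
    rw [Multiset.card_cons] at hc4
    by_cases hex : ∃ p ∈ M, g + p ≠ a
    · obtain ⟨p, hpM, hgp⟩ := hex
      obtain ⟨N, rfl⟩ := Multiset.exists_cons_of_mem hpM
      simp only [Multiset.mem_cons, not_or] at haM
      refine ⟨_, ⟨g, p, N, rfl, rfl⟩, ?_, .inr (.inr (.inl ⟨g + p, by simp, by omega⟩))⟩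
      simp only [Multiset.mem_cons, not_or]
      exact ⟨by omega, haM.2.2⟩
    · push Not at hex
      obtain ⟨p, hpM⟩ := Multiset.card_pos_iff_exists_mem.1 (show 0 < M.card by omega)
      have h1 := hex p hpM
      obtain ⟨M, rfl⟩ := Multiset.exists_cons_of_mem hpM
      rw [Multiset.card_cons] at hc4
      obtain ⟨q, hqM⟩ := Multiset.card_pos_iff_exists_mem.1 (show 0 < M.card by omega)
      have h2 := hex q (by simp [hqM])
      obtain ⟨N, rfl⟩ := Multiset.exists_cons_of_mem hqM
      simp only [Multiset.mem_cons, not_or] at haM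
      refine ⟨_, ⟨p, q, g ::ₘ N, ?_, rfl⟩, ?_, .inr (.inr (.inl ⟨g, by simp, hag⟩))⟩
      · rw [Multiset.cons_swap q g, Multiset.cons_swap p g]
      · simp only [Multiset.mem_cons, not_or]
        exact ⟨by omega, haM.1, haM.2.2.2⟩
  push Not at hbig
  obtain ⟨e, heM, hea⟩ := he
  have hea' := hbig e heM
  by_cases hhalf : ∃ h ∈ M, 2 * h = a
  · obtain ⟨h, hh, hha⟩ := hhalf
    obtain ⟨M, rfl⟩ := Multiset.exists_cons_of_mem hh
    have heM' : e ∈ M := (Multiset.mem_cons.1 heM).resolve_left (by rintro rfl; exact hea hha)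
    obtain ⟨N, rfl⟩ := Multiset.exists_cons_of_mem heM'
    simp only [Multiset.mem_cons, not_or] at haM
    have := hp e heM
    refine ⟨_, ⟨h, e, N, rfl, rfl⟩, ?_, .inr (.inr (.inl ⟨h + e, by simp, by omega⟩))⟩
    simp only [Multiset.mem_cons, not_or]
    exact ⟨by omega, haM.2.2⟩
  · push Not at hhalf
    obtain ⟨M, rfl⟩ := Multiset.exists_cons_of_mem heM
    rw [Multiset.card_cons] at hc4 hc
    obtain ⟨q, hqM⟩ := Multiset.card_pos_iff_exists_mem.1 (show 0 < M.card by omega)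
    have h1 := hbig q (by simp [hqM])
    obtain ⟨N, rfl⟩ := Multiset.exists_cons_of_mem hqM
    rw [Multiset.card_cons] at hc4 hc
    simp only [Multiset.mem_cons, not_or] at haM
    refine ⟨_, ⟨e, q, N, rfl, rfl⟩, ?_, ?_⟩
    · simp only [Multiset.mem_cons, not_or]
      exact ⟨by omega, haM.2.2⟩
    · have hN : N.countP (fun e => 2 * e ≠ a) = N.card :=
        Multiset.countP_eq_card.2 fun x hx => hhalf x (by simp [hx])
      unfold Untrapped
      rw [Multiset.card_cons, Multiset.countP_cons, hN]
      omega

theorem loses_single_of {a : ℕ} {M : Multiset ℕ} (ha : a ∉ M)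
    (h : ∀ N, Merge M N → Wins (a ::ₘ 0) N) : Loses (a ::ₘ 0) M := by
  rw [loses_iff]
  refine ⟨?_, h, ?_⟩
  · rintro _ ⟨x, y, K, hK, -⟩
    simpa using congrArg Multiset.card hK
  · rintro x R hR _ B hB rfl
    unfold Pick at hR hB
    obtain rfl : x = a := by
      simpa using (show x ∈ (a ::ₘ 0 : Multiset ℕ) by rw [hR]; simp)
    exact absurd (by rw [hB]; simp) ha

/-- Conditions on the blue stacks under which the player to move beats a lone red stack of
height `a`. -/
def Beatable (a : ℕ) (M : Multiset ℕ) : Prop :=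
  M.card % 2 = 0 ∧ 2 ≤ M.card ∧ (∀ e ∈ M, 0 < e) ∧ M.count a ≤ 1 ∧ M.sum ≠ a ∧ ∃ e ∈ M, 2 * e ≠ a

/-- Conditions on the blue stacks under which the player to move loses against a lone red stack
of height `a`. -/
def Safe (a : ℕ) (M : Multiset ℕ) : Prop :=
  M.card % 2 = 1 ∧ (∀ e ∈ M, 0 < e) ∧ a ∉ M ∧ M.sum ≠ a ∧ Untrapped a M

/-- Against a lone red stack the player to move keeps that stack from being matched. -/
theorem wins_single {a : ℕ} {M : Multiset ℕ} (h : Beatable a M) : Wins (a ::ₘ 0) M := by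
  obtain ⟨hc, hc2, hp, ha, hs, he⟩ := h
  induction hn : M.card using Nat.strong_induction_on generalizing M with
  | _ n ih =>
    by_cases hc4 : 4 ≤ M.card
    · obtain ⟨N, hN, haN, ht⟩ := exists_good_merge hc hc4 hp ha he
      have h1 := hN.card_add_one
      refine .intro (.blue hN) (loses_single_of haN fun K hK => ?_)
      have h2 := hK.card_add_one
      exact ih K.card (by omega) (by omega) (by omega) (hK.pos (hN.pos hp)) (hK.count_le_one haN)
        (by rwa [hK.sum_eq, hN.sum_eq])
        (ht.exists_of_merge (by omega) (by rwa [hN.sum_eq]) hK) rfl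
    · obtain ⟨x, y, rfl⟩ := Multiset.card_eq_two.1 (show M.card = 2 by omega)
      simp at hs
      refine .intro (.blue ⟨x, y, 0, rfl, rfl⟩) (loses_single_of (by simpa using Ne.symm hs) ?_)
      rintro N ⟨u, v, K, hK, -⟩
      simpa using congrArg Multiset.card hK

theorem loses_single {a : ℕ} {M : Multiset ℕ} (h : Safe a M) : Loses (a ::ₘ 0) M := by
  obtain ⟨hc, hp, ha, hs, ht⟩ := h
  refine loses_single_of ha fun N hN => ?_
  have := hN.card_add_one
  have : N.card ≠ 0 := by
    obtain ⟨x, y, K, rfl, rfl⟩ := hN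
    simp
  exact wins_single ⟨by omega, by omega, hN.pos hp, hN.count_le_one ha, by rwa [hN.sum_eq],
    ht.exists_of_merge hc hs hN⟩

theorem wins_pair {x y : ℕ} {M : Multiset ℕ} (h : Safe (x + y) M) : Wins (x ::ₘ y ::ₘ 0) M :=
  .red x y 0 (loses_single h) rfl rfl

attribute [simp] Beatable Safe Untrapped Multiset.count_cons Multiset.countP_cons count_ones
  countP_ones Multiset.count_singleton

theorem loses_two_one {a m : ℕ} (ha : 4 ≤ a) (hm : m % 2 = 1) (hm3 : 3 ≤ m) :
    Loses (2 ::ₘ 1 ::ₘ 0) (2 * a ::ₘ ones m) := by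
  simp only [loses_iff, forall_merge_cons, forall_merge_ones, forall_merge_zero, forall_pick_cons,
    forall_pick_ones, forall_pick_zero, and_true, true_and]
  and_intros
  all_goals intros
  · exact wins_single (by simp; grind)
  · exact wins_pair (by simp; grind)
  · exact wins_pair (by simp; grind)
  all_goals try omega
  · exact ⟨wins_pair (by simp; grind), wins_single (by simp; grind)⟩

theorem wins_even_pair {a₁ a₂ b m : ℕ} (h₁ : a₁ % 2 = 0) (h₂ : a₂ % 2 = 0) (hb : b % 2 = 0)
    (hm : m % 2 = 0) (h₁' : 0 < a₁) (h₂' : 0 < a₂) (hb' : 0 < b) (hne : a₁ + a₂ ≠ b + m) :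
    Wins (a₁ ::ₘ a₂ ::ₘ 0) (b ::ₘ ones m) := by
  by_cases hab : b = a₁ + a₂
  · obtain ⟨n, rfl⟩ : ∃ n, m = n + 1 := ⟨m - 1, by omega⟩
    refine .blue b 1 (ones n) ?_ (by rw [ones_succ]) rfl
    simp only [loses_iff, forall_merge_cons, forall_merge_ones, forall_merge_zero, forall_pick_cons,
      forall_pick_ones, forall_pick_zero, and_true, true_and]
    and_intros
    all_goals intros
    · exact wins_single (by simp; grind)
    · exact wins_pair (by simp; grind)
    · exact wins_pair (by simp; grind)
    all_goals omega
  · exact wins_pair (by simp; grind)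

theorem loses_pair_ones {x y m : ℕ} (hm : m % 2 = 0) (hx : 2 ≤ x) (hy : 2 ≤ y) (hxy : 6 ≤ x + y)
    (hne : x + y ≠ m) (hm2 : 2 ≤ m) : Loses (x ::ₘ y ::ₘ 0) (ones m) := by
  simp only [loses_iff, forall_merge_cons, forall_merge_ones, forall_merge_zero, forall_pick_cons,
    forall_pick_ones, forall_pick_zero, and_true, true_and]
  and_intros
  all_goals intros
  · exact wins_single (by simp; grind)
  · exact wins_pair (by simp; grind)
  all_goals omega

theorem loses_even_two {a b m : ℕ} (ha : 4 ≤ a) (ha2 : a % 2 = 0) (hb : 2 ≤ b) (hb2 : b % 2 = 0)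
    (hm : m % 2 = 1) (hm3 : 3 ≤ m) (hne : a + 2 ≠ b + 1 + m) :
    Loses (a ::ₘ 2 ::ₘ 0) ((b + 1) ::ₘ ones m) := by
  simp only [loses_iff, forall_merge_cons, forall_merge_ones, forall_merge_zero, forall_pick_cons,
    forall_pick_ones, forall_pick_zero, and_true, true_and]
  and_intros
  all_goals intros
  · exact wins_single (by simp; grind)
  · exact wins_even_pair (by omega) (by omega) (by omega) (by omega) (by omega) (by omega)
      (by omega) (by omega)
  · exact wins_pair (by simp; grind)
  all_goals omega

theorem loses_even_three_of_add_four {a m : ℕ} (ha : 4 ≤ a) (ha2 : a % 2 = 0)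
    (hm : m % 2 = 1) : Loses (a ::ₘ 3 ::ₘ 0) ((a + 4) ::ₘ ones m) := by
  simp only [loses_iff, forall_merge_cons, forall_merge_ones, forall_merge_zero, forall_pick_cons,
    forall_pick_ones, forall_pick_zero, and_true, true_and]
  and_intros
  all_goals intros
  · exact wins_single (by simp; grind)
  · exact wins_pair (by simp; grind)
  · exact wins_pair (by simp; grind)
  all_goals omega

theorem loses_even_three {a b m : ℕ} (ha : 4 ≤ a) (ha2 : a % 2 = 0) (hb : 2 ≤ b) (hb2 : b % 2 = 0)
    (hm : m % 2 = 1) (hm3 : 3 ≤ m) (hab : a ≠ b) (hne : a + 3 ≠ b + m) :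
    Loses (a ::ₘ 3 ::ₘ 0) (b ::ₘ ones m) := by
  simp only [loses_iff, forall_merge_cons, forall_merge_ones, forall_merge_zero, forall_pick_cons,
    forall_pick_ones, forall_pick_zero, and_true, true_and]
  and_intros
  all_goals intros
  · exact wins_single (by simp; grind)
  · rename_i n hn
    by_cases h : b = a + 2
    · obtain ⟨n, rfl⟩ : ∃ k, n = k + 1 := ⟨n - 1, by omega⟩
      refine .blue (a + 3) 1 (ones n) (loses_even_three_of_add_four ha ha2 (by omega)) ?_ rfl
      rw [ones_succ, h]
    · exact wins_pair (by simp; grind)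
  · exact wins_pair (by simp; grind)
  all_goals omega

theorem loses_even_one_of_two_ones {c m : ℕ} (hc : 8 ≤ c) (hc2 : c % 2 = 0) (hm : m = c + 1) :
    Loses (c ::ₘ 1 ::ₘ 0) (2 ::ₘ ones m) := by
  simp only [loses_iff, forall_merge_cons, forall_merge_ones, forall_merge_zero, forall_pick_cons,
    forall_pick_ones, forall_pick_zero, and_true, true_and]
  and_intros
  all_goals intros
  · exact wins_single (by simp; grind)
  · exact wins_pair (by simp; grind)
  · exact wins_pair (by simp; grind)
  all_goals try omega
  · rename_i n hn _
    obtain rfl : n = c := by omega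
    constructor
    · refine .captureByBlue 2 (ones n) ?_ rfl rfl rfl
      exact loses_single (by simp; grind)
    · exact wins_single (by simp; grind)

theorem loses_one_one_of_even_two {a : ℕ} (ha : 4 ≤ a) :
    Loses (1 ::ₘ 1 ::ₘ 0) ((2 * a + 2) ::ₘ 2 ::ₘ 0) := by
  simp only [loses_iff, forall_merge_cons, forall_merge_ones, forall_merge_zero, forall_pick_cons,
    forall_pick_ones, forall_pick_zero, and_true, true_and]
  and_intros
  all_goals intros
  · exact wins_single (by simp; grind)
  · exact wins_pair (by simp)
  all_goals omega

theorem loses_one_one_of_odd_one {a : ℕ} (ha : 4 ≤ a) :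
    Loses (1 ::ₘ 1 ::ₘ 0) ((2 * a + 3) ::ₘ 1 ::ₘ 0) := by
  simp only [loses_iff, forall_merge_cons, forall_merge_ones, forall_merge_zero, forall_pick_cons,
    forall_pick_ones, forall_pick_zero, and_true, true_and]
  and_intros
  all_goals intros
  · exact wins_single (by simp)
  · exact wins_pair (by simp)
  all_goals try omega
  · exact ⟨wins_pair (by simp; grind), wins_single (by simp; grind)⟩
  · exact ⟨wins_pair (by simp; grind), wins_single (by simp; grind)⟩

theorem loses_one_one_of_double_two_ones {a : ℕ} (ha : 4 ≤ a) :
    Loses (1 ::ₘ 1 ::ₘ 0) (2 * a ::ₘ 2 ::ₘ ones 2) := by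
  simp only [loses_iff, forall_merge_cons, forall_merge_ones, forall_merge_zero, forall_pick_cons,
    forall_pick_ones, forall_pick_zero, and_true, true_and]
  and_intros
  all_goals intros
  · exact wins_single (by simp; grind)
  · exact wins_pair (by simp; grind)
  · rename_i n hn
    obtain rfl : n = 1 := by omega
    exact .blue 2 (2 * a + 1) (1 ::ₘ 0) (loses_one_one_of_odd_one ha) (Multiset.cons_swap ..)
      (by congr 1; omega)
  · rename_i n hn
    obtain rfl : n = 1 := by omega
    exact wins_pair (by simp; grind)
  · rename_i n hn
    obtain rfl : n = 0 := by omega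
    refine .blue (2 * a) 2 (2 ::ₘ 0) (loses_one_one_of_even_two ha) rfl rfl
  all_goals try omega
  all_goals
    rename_i n hn _
    obtain rfl : n = 1 := by omega
    exact ⟨wins_pair (by simp; grind), wins_single (by simp; grind)⟩

theorem loses_odd_one_of_even_two {a : ℕ} (ha : 4 ≤ a) (ha2 : a % 2 = 0) :
    Loses ((a + 1) ::ₘ 1 ::ₘ 0) ((a + 4) ::ₘ 2 ::ₘ 0) := by
  simp only [loses_iff, forall_merge_cons, forall_merge_ones, forall_merge_zero, forall_pick_cons,
    forall_pick_ones, forall_pick_zero, and_true, true_and]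
  and_intros
  all_goals intros
  · exact wins_single (by simp; grind)
  · exact wins_pair (by simp)
  all_goals omega

theorem wins_capture_one {x : ℕ} {M N : Multiset ℕ} (h : Safe x (2 ::ₘ N))
    (hM : M = 1 ::ₘ N) : Wins (x ::ₘ 1 ::ₘ 0) M :=
  .captureByBlue 1 N (loses_single h) (Multiset.cons_swap ..) hM rfl

theorem loses_odd_one_of_even_two_ones {a b m : ℕ} (ha : 4 ≤ a) (ha2 : a % 2 = 0) (hb : 2 ≤ b)
    (hb2 : b % 2 = 0)
    (hm : 2 ≤ m) (hm2 : m % 2 = 0) (h₁ : a ≠ b + m) (h₂ : a + 2 ≠ b + m) (h₃ : a ≠ b + m + 2) :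
    Loses ((a + 1) ::ₘ 1 ::ₘ 0) (b ::ₘ 2 ::ₘ ones m) := by
  simp only [loses_iff, forall_merge_cons, forall_merge_ones, forall_merge_zero, forall_pick_cons,
    forall_pick_ones, forall_pick_zero, and_true, true_and]
  and_intros
  all_goals intros
  · exact wins_single (by simp; grind)
  · by_cases h : b = a
    · obtain ⟨n, rfl⟩ : ∃ n, m = n + 1 := ⟨m - 1, by omega⟩
      refine wins_capture_one (N := (b + 2) ::ₘ ones n) ?_
        (by simp [ones_succ, Multiset.cons_swap])
      simp; grind
    · exact wins_pair (by simp; grind)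
  · exact wins_pair (by simp; grind)
  · rename_i n hn
    by_cases h : b = a + 2
    · obtain ⟨n, rfl⟩ : ∃ k, n = k + 1 := ⟨n - 1, by omega⟩
      subst h
      refine wins_capture_one (N := (a + 2) ::ₘ 3 ::ₘ ones n) ?_
        (by simp [ones_succ, Multiset.cons_swap])
      simp; grind
    · exact wins_pair (by simp; grind)
  · rename_i n hn
    by_cases h : b = a + 2
    · cases n with
      | zero =>
        exact .blue (a + 2) 2 (2 ::ₘ 0) (loses_odd_one_of_even_two ha ha2)
          (by rw [h]; rfl) rfl
      | succ n =>
        refine wins_capture_one (N := b ::ₘ 2 ::ₘ 2 ::ₘ ones n) ?_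
          (by simp [ones_succ, Multiset.cons_swap])
        simp; grind
    · exact wins_pair (by simp; grind)
  all_goals try omega
  · exact ⟨wins_pair (by simp; grind), wins_single (by simp; grind)⟩

theorem loses_even_two_of_even_two_ones {a b m : ℕ} (ha : 4 ≤ a) (ha2 : a % 2 = 0) (hb : 2 ≤ b)
    (hb2 : b % 2 = 0)
    (hm : 2 ≤ m) (hm2 : m % 2 = 0) (hab : b < a) (h : a = b + m + 2 ∨ a + 2 = b + m) :
    Loses (a ::ₘ 2 ::ₘ 0) (b ::ₘ 2 ::ₘ ones m) := by
  simp only [loses_iff, forall_merge_cons, forall_merge_ones, forall_merge_zero, forall_pick_cons,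
    forall_pick_ones, forall_pick_zero, and_true, true_and]
  and_intros
  all_goals intros
  · exact wins_single (by simp; grind)
  · exact wins_even_pair (by omega) (by omega) (by omega) (by omega) (by omega) (by omega)
      (by omega) (by omega)
  · exact wins_pair (by simp; grind)
  · exact wins_pair (by simp; grind)
  · exact wins_pair (by simp; grind)
  all_goals try omega
  · rename_i hb
    subst hb
    refine ⟨?_, wins_single (by simp; grind)⟩
    exact wins_even_pair (by omega) (by omega) (by omega) (by omega) (by omega) (by omega)
      (by omega) (by omega)
  · refine ⟨?_, wins_single (by simp; grind)⟩
    exact wins_even_pair (by omega) (by omega) (by omega) (by omega) (by omega) (by omega)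
      (by omega) (by omega)

theorem loses_even_one_one {a b k : ℕ} (ha : 4 ≤ a) (ha2 : a % 2 = 0) (hb : 2 ≤ b) (hb2 : b % 2 = 0)
    (hk : 4 ≤ k) (hk2 : k % 2 = 0) (hne : a + 2 ≠ b + k) :
    Loses (a ::ₘ 1 ::ₘ 1 ::ₘ 0) (b ::ₘ ones k) := by
  have hred : Wins ((a + 1) ::ₘ 1 ::ₘ 0) (b ::ₘ ones k) := by
    by_cases h : b = a + 2
    · obtain ⟨n, rfl⟩ : ∃ n, k = n + 1 := ⟨k - 1, by omega⟩
      refine wins_capture_one (N := b ::ₘ ones n) ?_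
        (by simp [-Multiset.cons_zero, ones_succ, Multiset.cons_swap])
      simp; grind
    · exact wins_pair (by simp; grind)
  have hone : ∀ n, k = n + 1 → Wins (2 ::ₘ a ::ₘ 1 ::ₘ 0) (b ::ₘ ones n) ∧
      Wins (a ::ₘ 1 ::ₘ 0) (2 ::ₘ b ::ₘ ones n) := by
    intro n hn
    constructor
    · by_cases h : a = b
      · exact .captureByBlue a (ones n) (loses_two_one ha (by omega) (by omega))
          (by simp [-Multiset.cons_zero, Multiset.cons_swap]) (by rw [h]) rfl
      by_cases h' : a + 4 = b + k
      · obtain ⟨n, rfl⟩ : ∃ k, n = k + 1 := ⟨n - 1, by omega⟩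
        exact .captureByBlue 1 (b ::ₘ ones n)
          (loses_even_two_of_even_two_ones (b := b) (m := n) ha ha2 hb hb2 (by omega)
          (by omega) (by omega) (by omega)) (by simp [-Multiset.cons_zero, Multiset.cons_swap])
          (by simp [-Multiset.cons_zero, ones_succ, Multiset.cons_swap])
          (by simp [-Multiset.cons_zero, Multiset.cons_swap])
      · exact .red 2 1 (a ::ₘ 0)
          (loses_even_three (b := b) ha ha2 hb hb2 (m := n) (by omega) (by omega)
            h (by omega)) (by simp [-Multiset.cons_zero, Multiset.cons_swap])
            (by simp [-Multiset.cons_zero, Multiset.cons_swap])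
    · by_cases h : a = b + k
      · obtain ⟨n, rfl⟩ : ∃ k, n = k + 1 := ⟨n - 1, by omega⟩
        exact .captureByRed 1 (a ::ₘ 0)
          (loses_even_two_of_even_two_ones (b := b) (m := n) ha ha2 hb hb2 (by omega)
          (by omega) (by omega) (by omega)) (by simp [-Multiset.cons_zero, Multiset.cons_swap])
          (by simp [-Multiset.cons_zero, ones_succ, Multiset.cons_swap])
          (by simp [-Multiset.cons_zero, Multiset.cons_swap])
      · exact wins_pair (by simp; grind)
  simp only [loses_iff, forall_merge_cons, forall_merge_ones, forall_merge_zero, forall_pick_cons,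
    forall_pick_ones, forall_pick_zero, and_true, true_and]
  and_intros
  all_goals intros
  · exact hred
  · exact hred
  · exact wins_even_pair (by omega) (by omega) (by omega) (by omega) (by omega) (by omega)
      (by omega) (by omega)
  · exact .red 1 1 (a ::ₘ 0) (loses_even_two ha ha2 hb hb2 (by omega) (by omega) (by omega))
      (by simp [-Multiset.cons_zero, Multiset.cons_swap])
      (by simp [-Multiset.cons_zero, Multiset.cons_swap])
  · rename_i n hn
    by_cases h : a = b
    · subst h
      by_cases hn2 : n = 2
      · subst hn2
        exact .captureByBlue a (2 ::ₘ ones 2) (loses_one_one_of_double_two_ones ha) rfl rfl rfl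
      · exact .red a 1 (1 ::ₘ 0)
          (loses_odd_one_of_even_two_ones ha ha2 hb hb2 (by omega) (by omega) (by omega)
          (by omega) (by omega)) rfl rfl
    by_cases h' : a = b + k ∨ a + 4 = b + k
    · exact .red 1 1 (a ::ₘ 0)
        (loses_even_two_of_even_two_ones (b := b) (m := n) ha ha2 hb hb2 (by omega)
        (by omega) (by omega) (by omega)) (by simp [-Multiset.cons_zero, Multiset.cons_swap])
        (by simp [-Multiset.cons_zero, Multiset.cons_swap])
    · exact .red a 1 (1 ::ₘ 0)
        (loses_odd_one_of_even_two_ones ha ha2 hb hb2 (by omega) (by omega) (by omega)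
          (by omega) (by omega)) rfl rfl
  all_goals try omega
  · rename_i h
    refine ⟨?_, wins_pair (by simp; grind)⟩
    by_cases h' : 2 * a + 2 = k
    · obtain ⟨n, rfl⟩ : ∃ n, k = n + 1 := ⟨k - 1, by omega⟩
      exact .captureByBlue 1 (ones n)
        (loses_even_one_of_two_ones (c := 2 * a) (m := n) (by omega) (by omega)
        (by omega)) (Multiset.cons_swap ..) (ones_succ n) rfl
    · exact .red 1 1 (2 * a ::ₘ 0) (loses_pair_ones (x := 2 * a) (y := 2) hk2 (by omega) (by omega)
        (by omega) (by omega) (by omega)) (by simp [-Multiset.cons_zero, Multiset.cons_swap])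
        (by simp [-Multiset.cons_zero, Multiset.cons_swap])
  · exact hone _ (by assumption)
  · exact hone _ (by assumption)

theorem untrapped_of_odd {a : ℕ} {M : Multiset ℕ} (ha : a % 2 = 1) : Untrapped a M := by
  have : M.countP (fun e => 2 * e ≠ a) = M.card := Multiset.countP_eq_card.2 fun e _ => by omega
  rw [Untrapped, this]
  omega

theorem card_le_sum {M : Multiset ℕ} (hp : ∀ e ∈ M, 0 < e) : M.card ≤ M.sum := by
  simpa using Multiset.card_nsmul_le_sum (a := 1) fun e he => hp e he

theorem count_le_one_of_sum_lt {a : ℕ} {M : Multiset ℕ} (h : M.sum < 2 * a) : M.count a ≤ 1 := by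
  by_contra! hc
  obtain ⟨K, rfl⟩ := Multiset.le_iff_exists_add.1 (Multiset.le_count_iff_replicate_le.1 hc)
  simp at h
  omega

theorem loses_odd_two {r : ℕ} {M : Multiset ℕ} (hr : r % 2 = 1) (hr5 : 5 ≤ r)
    (hc : M.card % 2 = 0) (hp : ∀ e ∈ M, 0 < e) (hs : M.sum = r + 4) :
    Loses (r ::ₘ 2 ::ₘ 0) M := by
  have h0 : 2 ≤ M.card := by
    have : M.card ≠ 0 := fun h => by simp [Multiset.card_eq_zero.1 h] at hs
    omega
  obtain ⟨e, he⟩ := Multiset.card_pos_iff_exists_mem.1 (show 0 < M.card by omega)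
  simp only [loses_iff, forall_merge_cons, forall_merge_zero, forall_pick_cons, forall_pick_zero,
    and_true]
  refine ⟨?_, ?_, ?_, ?_⟩
  · exact wins_single ⟨hc, h0, hp, count_le_one_of_sum_lt (by omega), by omega, e, he, by omega⟩
  · intro N hN
    have hNs := hN.sum_eq
    have hNc := hN.card_add_one
    have hNp := hN.pos hp
    by_cases hmem : r + 2 ∈ N
    · obtain ⟨K, rfl⟩ := Multiset.exists_cons_of_mem hmem
      have hK : ∀ e ∈ K, 0 < e := fun e he => hNp e (by simp [he])
      have := card_le_sum hK
      simp only [Multiset.sum_cons, Multiset.card_cons] at hNs hNc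
      have : K.card ≠ 0 := fun h => by simp [Multiset.card_eq_zero.1 h] at hNs; omega
      obtain ⟨x, y, rfl⟩ := Multiset.card_eq_two.1 (show K.card = 2 by omega)
      have hx := hK x (by simp)
      have hy := hK y (by simp)
      simp at hNs
      obtain rfl : x = 1 := by omega
      obtain rfl : y = 1 := by omega
      refine .blue (r + 2) 1 (1 ::ₘ 0) ?_ rfl rfl
      simp only [loses_iff, forall_merge_cons, forall_merge_ones, forall_merge_zero,
        forall_pick_cons,
        forall_pick_ones, forall_pick_zero, and_true, true_and]
      and_intros
      · exact wins_single (by simp; grind)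
      · exact wins_pair (by simp)
      all_goals omega
    · exact wins_pair ⟨by omega, hNp, hmem, by omega, untrapped_of_odd (by omega)⟩
  · rintro _ N h rfl
    obtain rfl : M = r ::ₘ N := h
    have hN : ∀ e ∈ N, 0 < e := fun e he => hp e (by simp [he])
    have := card_le_sum hN
    simp only [Multiset.sum_cons, Multiset.card_cons] at hs hc
    constructor
    · refine wins_pair ⟨by omega, hN, fun h => ?_, by omega, .inr (.inl (by omega))⟩
      have := Multiset.le_sum_of_mem h
      omega
    · refine wins_single ⟨by simp; omega, by simp; omega, by simp; grind, ?_, by simp; omega,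
        2 * r, by simp, by omega⟩
      rw [Multiset.count_cons, if_neg (by omega)]
      by_contra! hc2
      obtain ⟨K, rfl⟩ := Multiset.le_iff_exists_add.1 (Multiset.le_count_iff_replicate_le.1 hc2)
      have : K.card ≤ K.sum := card_le_sum fun e he => hN e (by simp [he])
      simp at hs hc
      omega
  · rintro _ N h rfl
    obtain rfl : M = 2 ::ₘ N := h
    have hN : ∀ e ∈ N, 0 < e := fun e he => hp e (by simp [he])
    simp only [Multiset.sum_cons, Multiset.card_cons] at hs hc h0
    constructor
    · refine .red 4 r 0 (loses_single ⟨by omega, hN, fun h => ?_, by omega,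
        untrapped_of_odd (by omega)⟩) rfl rfl
      have := Multiset.le_sum_of_mem h
      omega
    · refine wins_single ⟨by simp; omega, by simp; omega, by simp; grind, ?_, by simp; omega,
        4, by simp, by omega⟩
      rw [Multiset.count_cons, if_neg (by omega)]
      exact count_le_one_of_sum_lt (by omega)

theorem loses_even_two_of_four_even_ones {b c m : ℕ} (hb : 4 ≤ b) (hb2 : b % 2 = 0) (hc : b ≤ c)
    (hc2 : c % 2 = 0) (hm : 2 ≤ m) (hm2 : m % 2 = 0) (h : c + 2 = b + m) :
    Loses (c ::ₘ 2 ::ₘ 0) (4 ::ₘ b ::ₘ ones m) := by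
  simp only [loses_iff, forall_merge_cons, forall_merge_ones, forall_merge_zero, forall_pick_cons,
    forall_pick_ones, forall_pick_zero, and_true, true_and]
  and_intros
  all_goals intros
  · exact wins_single (by simp; grind)
  · exact wins_even_pair (by omega) (by omega) (by omega) (by omega) (by omega) (by omega)
      (by omega) (by omega)
  · exact wins_pair (by simp; grind)
  · exact wins_pair (by simp; grind)
  · exact wins_pair (by simp; grind)
  all_goals try omega
  · refine ⟨?_, wins_single (by simp; grind)⟩
    exact wins_even_pair (by omega) (by omega) (by omega) (by omega) (by omega) (by omega)
      (by omega) (by omega)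
  · refine ⟨?_, wins_single (by simp; grind)⟩
    exact wins_even_pair (by omega) (by omega) (by omega) (by omega) (by omega) (by omega)
      (by omega) (by omega)

theorem loses_pair_of_sum_lt {x y : ℕ} {M : Multiset ℕ} (hp : ∀ e ∈ M, 0 < e) (hx : x ∉ M)
    (hy : y ∉ M) (hc : M.card % 2 = 0) (hc2 : 2 ≤ M.card) (hs : M.sum < x + y) :
    Loses (x ::ₘ y ::ₘ 0) M := by
  simp only [loses_iff, forall_merge_cons, forall_merge_zero, forall_pick_cons, forall_pick_zero,
    and_true]
  refine ⟨?_, ?_, ?_, ?_⟩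
  · refine wins_single ⟨hc, hc2, hp, count_le_one_of_sum_lt (by omega), by omega, ?_⟩
    obtain ⟨e, he⟩ := Multiset.card_pos_iff_exists_mem.1 (show 0 < M.card by omega)
    obtain ⟨M, rfl⟩ := Multiset.exists_cons_of_mem he
    rw [Multiset.card_cons] at hc2
    obtain ⟨f, hf⟩ := Multiset.card_pos_iff_exists_mem.1 (show 0 < M.card by omega)
    have := Multiset.le_sum_of_mem hf
    rw [Multiset.sum_cons] at hs
    by_cases h : 2 * e = x + y
    · exact ⟨f, by simp [hf], by omega⟩
    · exact ⟨e, he, h⟩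
  · intro N hN
    have hNs := hN.sum_eq
    have hNc := hN.card_add_one
    refine wins_pair ⟨by omega, hN.pos hp, fun h => ?_, by omega, .inr (.inl (by omega))⟩
    have := Multiset.le_sum_of_mem h
    omega
  · rintro _ N h rfl
    exact absurd (by rw [show M = _ from h]; simp) hx
  · rintro _ N h rfl
    exact absurd (by rw [show M = _ from h]; simp) hy

theorem loses_four_even_two_of_two_ones {c : ℕ} (hc : 4 ≤ c) (hc2 : c % 2 = 0) :
    Loses (4 ::ₘ c ::ₘ 2 ::ₘ 0) (2 ::ₘ ones c) := by
  simp only [loses_iff, forall_merge_cons, forall_merge_ones, forall_merge_zero, forall_pick_cons,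
    forall_pick_ones, forall_pick_zero, and_true, true_and]
  and_intros
  all_goals intros
  · exact wins_pair (by simp; grind)
  · exact wins_pair (by simp; grind)
  · exact wins_pair (by simp; grind)
  · refine .red c 2 (4 ::ₘ 0) (loses_pair_of_sum_lt ?_ ?_ ?_ ?_ ?_ ?_) ?_ rfl
    on_goal 7 => simp [-Multiset.cons_zero, Multiset.cons_swap]
    all_goals simp <;> grind
  · refine .red c 2 (4 ::ₘ 0) (loses_pair_of_sum_lt ?_ ?_ ?_ ?_ ?_ ?_) ?_ rfl
    on_goal 7 => simp [-Multiset.cons_zero, Multiset.cons_swap]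
    all_goals simp <;> grind
  all_goals try omega
  · constructor
    · exact .red c 4 (4 ::ₘ 0) (loses_pair_ones hc2 (by omega) (by omega) (by omega) (by omega)
        (by omega)) (by simp [-Multiset.cons_zero, Multiset.cons_swap]) rfl
    · exact .captureByRed 4 (c ::ₘ 0) (loses_pair_ones hc2 (by omega) (by omega) (by omega)
        (by omega) (by omega)) rfl rfl rfl

theorem loses_double_succ_two_of_two_ones {c : ℕ} (hc : 2 ≤ c) (hc2 : c % 2 = 0) :
    Loses ((2 * c + 1) ::ₘ 2 ::ₘ 0) (2 ::ₘ ones 3) := by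
  simp only [loses_iff, forall_merge_cons, forall_merge_ones, forall_merge_zero, forall_pick_cons,
    forall_pick_ones, forall_pick_zero, and_true, true_and]
  and_intros
  all_goals intros
  · exact wins_single (by simp; grind)
  · exact wins_pair (by simp; grind)
  · exact wins_pair (by simp; grind)
  all_goals try omega
  · exact ⟨wins_pair (by simp; grind), wins_single (by simp; grind)⟩

theorem loses_odd_four_of_even_ones {b c m : ℕ} (hb : 2 ≤ b) (hb2 : b % 2 = 0) (hc : 4 ≤ c)
    (hc2 : c % 2 = 0) (hm : m % 2 = 1) (hm3 : 3 ≤ m) (h : c + 3 = b + m) :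
    Loses ((c + 1) ::ₘ 4 ::ₘ 0) (b ::ₘ ones m) := by
  simp only [loses_iff, forall_merge_cons, forall_merge_ones, forall_merge_zero, forall_pick_cons,
    forall_pick_ones, forall_pick_zero, and_true, true_and]
  and_intros
  all_goals intros
  · exact wins_single (by simp; grind)
  · exact wins_pair (by simp; grind)
  · exact wins_pair (by simp; grind)
  all_goals try omega
  · exact ⟨wins_pair (by simp; grind), wins_single (by simp; grind)⟩

theorem loses_even_two_one_of_two_even_ones {b c m : ℕ} (hb : 2 ≤ b) (hb2 : b % 2 = 0) (hc : 4 ≤ c)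
    (hc2 : c % 2 = 0) (hm : m % 2 = 1) (hm3 : 3 ≤ m) (h : c + 3 = b + m) :
    Loses (c ::ₘ 2 ::ₘ 1 ::ₘ 0) (2 ::ₘ b ::ₘ ones m) := by
  have htwo {M : Multiset ℕ} (hM : M = b ::ₘ ones m) : Wins (4 ::ₘ c ::ₘ 1 ::ₘ 0) M ∧
      Wins (c ::ₘ 1 ::ₘ 0) (4 ::ₘ M) := by
    subst hM
    constructor
    · exact .red c 1 (4 ::ₘ 0) (loses_odd_four_of_even_ones hb hb2 hc hc2 hm hm3 h)
        (by simp [-Multiset.cons_zero, Multiset.cons_swap]) rfl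
    · exact wins_pair (by simp; grind)
  have hblue {M : Multiset ℕ} (h : M.card % 2 = 0 ∧ (∀ e ∈ M, 0 < e) ∧ M.sum = c + 5) :
      Wins (c ::ₘ 2 ::ₘ 1 ::ₘ 0) M :=
    .red c 1 (2 ::ₘ 0) (loses_odd_two (r := c + 1) (by omega) (by omega) h.1 h.2.1 h.2.2)
      (by simp [-Multiset.cons_zero, Multiset.cons_swap]) rfl
  simp only [loses_iff, forall_merge_cons, forall_merge_ones, forall_merge_zero, forall_pick_cons,
    forall_pick_ones, forall_pick_zero, and_true, true_and]
  and_intros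
  all_goals intros
  · exact wins_pair (by simp; grind)
  · exact wins_pair (by simp; grind)
  · exact wins_pair (by simp; grind)
  · exact hblue (by simp; grind)
  · exact hblue (by simp; grind)
  · exact hblue (by simp; grind)
  · exact hblue (by simp; grind)
  all_goals try omega
  · rename_i hcb
    subst hcb
    obtain rfl : m = 3 := by omega
    constructor
    · exact .red (2 * c) 1 (2 ::ₘ 0) (loses_double_succ_two_of_two_ones (by omega) hc2)
        (by simp [-Multiset.cons_zero, Multiset.cons_swap]) rfl
    · exact wins_pair (by simp; grind)
  · exact htwo rfl
  · rename_i h2b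
    exact htwo (by rw [← h2b])
  · rename_i n hn _
    constructor
    · by_cases hb4 : b = 2
      · subst hb4
        obtain rfl : n = c := by omega
        exact .captureByRed 2 (n ::ₘ 2 ::ₘ 0) (loses_four_even_two_of_two_ones hc hc2) rfl rfl rfl
      · exact .captureByBlue 2 (b ::ₘ ones n)
          (loses_even_two_of_four_even_ones (by omega) hb2 (by omega) hc2
          (by omega) (by omega) (by omega)) rfl rfl rfl
    · exact wins_pair (by simp; grind)

theorem loses_five_two_two : Loses (5 ::ₘ 2 ::ₘ 2 ::ₘ 0) (ones 3) := by
  simp only [loses_iff, forall_merge_cons, forall_merge_ones, forall_merge_zero, forall_pick_cons,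
    forall_pick_ones, forall_pick_zero, and_true, true_and]
  and_intros
  all_goals intros
  · exact wins_pair (by simp)
  · exact wins_pair (by simp)
  · exact wins_pair (by simp)
  · rename_i n hn
    obtain rfl : n = 1 := by omega
    exact .red 2 2 (5 ::ₘ 0) (loses_pair_of_sum_lt (x := 4) (y := 5) (by simp) (by simp) (by simp)
      (by simp) (by simp) (by simp)) (by simp [-Multiset.cons_zero, Multiset.cons_swap]) rfl
  all_goals omega

theorem loses_four_two_two : Loses (4 ::ₘ 2 ::ₘ 2 ::ₘ 0) (2 ::ₘ ones 2) := by
  have hcap : Wins (4 ::ₘ 4 ::ₘ 2 ::ₘ 0) (ones 2) ∧ Wins (4 ::ₘ 2 ::ₘ 0) (4 ::ₘ ones 2) := by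
    constructor
    · exact .red 4 2 (4 ::ₘ 0) (loses_pair_ones (by simp) (by simp) (by simp) (by simp) (by simp)
        (by simp)) (by simp [-Multiset.cons_zero, Multiset.cons_swap]) rfl
    · exact .captureByRed 4 (2 ::ₘ 0) (loses_pair_ones (by simp) (by simp) (by simp) (by simp)
        (by simp) (by simp)) rfl rfl rfl
  simp only [loses_iff, forall_merge_cons, forall_merge_ones, forall_merge_zero, forall_pick_cons,
    forall_pick_ones, forall_pick_zero, and_true, true_and]
  and_intros
  all_goals intros
  · exact wins_pair (by simp)
  · exact wins_pair (by simp)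
  · exact wins_pair (by simp)
  · rename_i n hn
    obtain rfl : n = 1 := by omega
    exact .red 2 2 (4 ::ₘ 0) (loses_pair_of_sum_lt (x := 4) (y := 4) (by simp) (by simp) (by simp)
      (by simp) (by simp) (by simp)) (by simp [-Multiset.cons_zero, Multiset.cons_swap]) rfl
  · rename_i n hn
    obtain rfl : n = 0 := by omega
    exact .red 2 2 (4 ::ₘ 0) (loses_pair_of_sum_lt (x := 4) (y := 4) (by simp) (by simp) (by simp)
      (by simp) (by simp) (by simp)) (by simp [-Multiset.cons_zero, Multiset.cons_swap]) rfl
  all_goals first | exact hcap | omega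

theorem loses_four_two_one_one : Loses (4 ::ₘ 2 ::ₘ 1 ::ₘ 1 ::ₘ 0) (ones 4) := by
  have hpair {x y : ℕ} (hx : 2 ≤ x) (hy : 2 ≤ y) (hxy : 8 ≤ x + y) :
      Loses (x ::ₘ y ::ₘ 0) (ones 4) :=
    loses_pair_ones (by simp) hx hy (by omega) (by omega) (by simp)
  have hone : ∀ n, 4 = n + 1 → Wins (2 ::ₘ 4 ::ₘ 2 ::ₘ 1 ::ₘ 0) (ones n) ∧
      Wins (4 ::ₘ 2 ::ₘ 1 ::ₘ 0) (2 ::ₘ ones n) := by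
    intro n hn
    obtain rfl : n = 3 := by omega
    constructor
    · exact .red 4 1 (2 ::ₘ 2 ::ₘ 0) loses_five_two_two
        (by simp [-Multiset.cons_zero, Multiset.cons_swap]) rfl
    · exact .red 4 1 (2 ::ₘ 0) (loses_double_succ_two_of_two_ones (c := 2) (by simp) (by simp))
        (by simp [-Multiset.cons_zero, Multiset.cons_swap]) rfl
  simp only [loses_iff, forall_merge_cons, forall_merge_ones, forall_merge_zero, forall_pick_cons,
    forall_pick_ones, forall_pick_zero, and_true, true_and]
  and_intros
  all_goals intros
  · exact .red 1 1 (6 ::ₘ 0) (hpair (by simp) (by simp) (by simp))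
      (by simp [-Multiset.cons_zero, Multiset.cons_swap]) rfl
  · exact .red 5 1 (2 ::ₘ 0) (hpair (by simp) (by simp) (by simp))
      (by simp [-Multiset.cons_zero, Multiset.cons_swap]) rfl
  · exact .red 5 1 (2 ::ₘ 0) (hpair (by simp) (by simp) (by simp))
      (by simp [-Multiset.cons_zero, Multiset.cons_swap]) rfl
  · exact .red 3 1 (4 ::ₘ 0) (hpair (by simp) (by simp) (by simp))
      (by simp [-Multiset.cons_zero, Multiset.cons_swap]) rfl
  · exact .red 3 1 (4 ::ₘ 0) (hpair (by simp) (by simp) (by simp))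
      (by simp [-Multiset.cons_zero, Multiset.cons_swap]) rfl
  · exact .red 2 2 (4 ::ₘ 0) (hpair (by simp) (by simp) (by simp))
      (by simp [-Multiset.cons_zero, Multiset.cons_swap]) rfl
  · rename_i n hn
    obtain rfl : n = 2 := by omega
    exact .red 1 1 (4 ::ₘ 2 ::ₘ 0) loses_four_two_two
      (by simp [-Multiset.cons_zero, Multiset.cons_swap])
      (by simp [-Multiset.cons_zero, Multiset.cons_swap])
  all_goals try omega
  · exact hone _ (by assumption)
  · exact hone _ (by assumption)

theorem wins_position_two {k u v : ℕ} (hk : 4 ≤ k) (hk2 : k % 2 = 0) (hu : 1 ≤ u) (hv : 1 ≤ v) :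
    Wins (2 * u ::ₘ 2 ::ₘ 1 ::ₘ 1 ::ₘ 0) (2 * v ::ₘ ones k) := by
  by_cases h : 2 * u + 4 = 2 * v + k
  · by_cases hu1 : u = 1
    · obtain rfl : v = 1 := by omega
      obtain rfl : k = 4 := by omega
      subst hu1
      exact .captureByRed 2 (2 ::ₘ 1 ::ₘ 1 ::ₘ 0) loses_four_two_one_one rfl rfl rfl
    · obtain ⟨n, rfl⟩ : ∃ n, k = n + 1 := ⟨k - 1, by omega⟩
      exact .captureByBlue 1 (2 * v ::ₘ ones n)
        (loses_even_two_one_of_two_even_ones (c := 2 * u) (b := 2 * v) (m := n)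
        (by omega) (by omega) (by omega) (by omega) (by omega) (by omega) (by omega))
          (by simp [-Multiset.cons_zero, Multiset.cons_swap])
        (by rw [ones_succ, Multiset.cons_swap]) rfl
  · exact .red (2 * u) 2 (1 ::ₘ 1 ::ₘ 0)
      (loses_even_one_one (by omega) (by omega) (by omega) (by omega)
      (by omega) (by omega) (by omega)) rfl rfl

/-- The multiset of heights of the stacks of `P` with top chip `c`. -/
def heights (c : Bool) (P : Position) : Multiset ℕ :=
  (P.filter fun s => s.head? = some c).map List.length

theorem heights_cons {c : Bool} {s : Stack} {P : Position} :
    heights c (s ::ₘ P) =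
      if s.head? = some c then s.length ::ₘ heights c P else heights c P := by
  unfold heights
  split_ifs with h <;> simp [h]

theorem exists_cons_of_heights_eq {c : Bool} {P : Position} {x : ℕ} {N : Multiset ℕ}
    (h : heights c P = x ::ₘ N) : ∃ s Q, P = s ::ₘ Q ∧ s.head? = some c ∧ s.length = x ∧
      heights c Q = N ∧ heights (!c) Q = heights (!c) P := by
  have hx : x ∈ heights c P := h ▸ Multiset.mem_cons_self x N
  obtain ⟨s, hs, rfl⟩ := Multiset.mem_map.1 hx
  obtain ⟨hs, hc⟩ := Multiset.mem_filter.1 hs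
  obtain ⟨Q, rfl⟩ := Multiset.exists_cons_of_mem hs
  refine ⟨s, Q, rfl, hc, rfl, ?_, ?_⟩
  · rwa [heights_cons, if_pos hc, Multiset.cons_inj_right] at h
  · rw [heights_cons, if_neg (by simp [hc])]

theorem head?_append_of_head? {c : Bool} {s t : Stack} (h : s.head? = some c) :
    (s ++ t).head? = some c := by
  simp [List.head?_append, h]

theorem ne_nil_of_head? {c : Bool} {s : Stack} (h : s.head? = some c) : s ≠ [] := by
  rintro rfl
  simp at h

theorem exists_head?_eq {s : Stack} (h : s ≠ []) : ∃ c, s.head? = some c :=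
  ⟨s.head h, List.head?_eq_some_head h⟩

theorem move_iff {P Q : Position} : Move P Q ↔ ∃ s t K, s ≠ [] ∧ t ≠ [] ∧
    (s.length = t.length ∨ s.head? = t.head?) ∧ P = s ::ₘ t ::ₘ K ∧ Q = (s ++ t) ::ₘ K := by
  constructor
  · rintro ⟨s, t, hs, ht, hsP, htP, h, rfl⟩
    exact ⟨s, t, _, hs, ht, h, by rw [Multiset.cons_erase htP, Multiset.cons_erase hsP], rfl⟩
  · rintro ⟨s, t, K, hs, ht, h, rfl, rfl⟩
    exact ⟨s, t, hs, ht, by simp, by simp, h, by simp⟩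

theorem HeightMove.of_move {P Q : Position} (hm : Move P Q) :
    HeightMove (heights true P) (heights false P) (heights true Q) (heights false Q) := by
  obtain ⟨s, t, K, hs, ht, h, rfl, rfl⟩ := move_iff.1 hm
  clear hm
  obtain ⟨c, hc⟩ := exists_head?_eq hs
  obtain ⟨d, hd⟩ := exists_head?_eq ht
  have hst := head?_append_of_head? (t := t) hc
  have h2 : s.length = t.length → s.length + t.length = 2 * s.length := fun h => by omega
  simp only [heights_cons, hc, hd, hst, List.length_append]
  cases c <;> cases d <;> simp [hc, hd] at h ⊢
  · exact .blue ⟨_, _, _, rfl, rfl⟩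
  · rw [h2 h, ← h]
    exact .captureByBlue rfl rfl
  · rw [h2 h, ← h]
    exact .captureByRed rfl rfl
  · exact .red ⟨_, _, _, rfl, rfl⟩

theorem HeightMove.exists_move {P : Position} {R B R' B' : Multiset ℕ} (h : HeightMove R B R' B')
    (hR : heights true P = R) (hB : heights false P = B) :
    ∃ Q, Move P Q ∧ heights true Q = R' ∧ heights false Q = B' := by
  have same (c : Bool) {M N : Multiset ℕ} (hM : Merge M N) (hP : heights c P = M) :
      ∃ Q, Move P Q ∧ heights c Q = N ∧ heights (!c) Q = heights (!c) P := by
    obtain ⟨x, y, K, rfl, rfl⟩ := hM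
    obtain ⟨s, Q, rfl, hs, rfl, hQ, hQ'⟩ := exists_cons_of_heights_eq hP
    obtain ⟨t, Q, rfl, ht, rfl, rfl, hQ₁⟩ := exists_cons_of_heights_eq hQ
    have hst := head?_append_of_head? (t := t) hs
    refine ⟨(s ++ t) ::ₘ Q, move_iff.2 ⟨s, t, Q, ne_nil_of_head? hs, ne_nil_of_head? ht,
      .inr (hs.trans ht.symm), rfl, rfl⟩, ?_, ?_⟩
    · rw [heights_cons, if_pos hst, List.length_append]
    · rw [heights_cons, if_neg (by simp [hst]), hQ₁, hQ']
  have capture (c : Bool) {x : ℕ} {M N : Multiset ℕ} (hM : heights c P = x ::ₘ M)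
      (hN : heights (!c) P = x ::ₘ N) :
      ∃ Q, Move P Q ∧ heights c Q = 2 * x ::ₘ M ∧ heights (!c) Q = N := by
    obtain ⟨s, Q, rfl, hs, rfl, hQ, hQ'⟩ := exists_cons_of_heights_eq hM
    rw [← hQ'] at hN
    obtain ⟨t, Q, rfl, ht, htl, rfl, hQ₁⟩ := exists_cons_of_heights_eq hN
    have hst := head?_append_of_head? (t := t) hs
    refine ⟨(s ++ t) ::ₘ Q, move_iff.2 ⟨s, t, Q, ne_nil_of_head? hs, ne_nil_of_head? ht,
      .inl htl.symm, rfl, rfl⟩, ?_, ?_⟩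
    · rw [Bool.not_not] at hQ₁
      rw [heights_cons, if_pos hst, List.length_append, htl, hQ₁, hQ, two_mul]
    · rw [heights_cons, if_neg (by simp [hst])]
  subst hR hB
  cases h with
  | red h => exact same true h rfl
  | blue h =>
    obtain ⟨Q, h₁, h₂, h₃⟩ := same false h rfl
    exact ⟨Q, h₁, h₃, h₂⟩
  | captureByRed h h' => exact capture true h h'
  | captureByBlue h h' =>
    obtain ⟨Q, h₁, h₂, h₃⟩ := capture false h' h
    exact ⟨Q, h₁, h₃, h₂⟩

theorem Wins.firstWin {R B : Multiset ℕ} (h : Wins R B) (P : Position)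
    (hR : heights true P = R) (hB : heights false P = B) : FirstWin P := by
  induction h generalizing P with
  | intro h _ ih =>
    obtain ⟨Q, hPQ, rfl, rfl⟩ := h.exists_move hR hB
    have hcard {P Q : Position} (h : Move P Q) : Multiset.card P = Multiset.card Q + 1 := by
      obtain ⟨s, t, K, -, -, -, rfl, rfl⟩ := move_iff.1 h
      simp
    rw [FirstWin, hcard hPQ]
    refine ⟨Q, hPQ, fun hQ => ?_⟩
    cases hn : Multiset.card Q with
    | zero => rwa [hn] at hQ
    | succ n =>
      rw [hn] at hQ
      obtain ⟨Q', hQ', hlose⟩ := hQ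
      have hwin := ih _ _ (HeightMove.of_move hQ') Q' rfl rfl
      have hc := hcard hQ'
      rw [FirstWin, show Multiset.card Q' = n by omega] at hwin
      exact hlose hwin

theorem heights_add (c : Bool) (P Q : Position) :
    heights c (P + Q) = heights c P + heights c Q := by
  simp [heights]

theorem heights_replicate (c : Bool) (n : ℕ) (s : Stack) :
    heights c (Multiset.replicate n s) =
      if s.head? = some c then Multiset.replicate n s.length else 0 := by
  induction n with
  | zero => simp [heights]
  | succ n ih =>
    rw [Multiset.replicate_succ, heights_cons, ih]
    split_ifs <;> simp

/-- Every position `⟨2, k; 2u, 2; 2v⟩` with `k ≥ 4` even and `u, v ≥ 1` is a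
first-player win. -/
theorem position_two (k u v : ℕ) (R R' B : Stack)
    (hk : 4 ≤ k) (hkeven : Even k)
    (hu : 1 ≤ u) (hv : 1 ≤ v)
    (hR : R.head? = some true) (hRlen : R.length = 2 * u)
    (hR' : R'.head? = some true) (hR'len : R'.length = 2)
    (hB : B.head? = some false) (hBlen : B.length = 2 * v) :
    FirstWin (R ::ₘ R' ::ₘ B ::ₘ
      (Multiset.replicate 2 [true] + Multiset.replicate k [false])) := by
  refine (wins_position_two hk (Nat.even_iff.1 hkeven) hu hv).firstWin _ ?_ ?_
  · simp [heights_cons, heights_add, heights_replicate, hR, hR', hB, hRlen, hR'len,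
      Multiset.replicate_succ]
  · simp [heights_cons, heights_add, heights_replicate, hR, hR', hB, hBlen, ones]
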